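/- For every κ with 0 < κ < √2 and every real x̃, setting b = κ·x̃/√2, the quantity (1/(2√(π(2−κ²)))) · ∫_{ℝ²} exp{−(1/2)(λ₁²+λ₂²) + ((1−κ²)/(4(2−κ²)))(λ₁+λ₂)²} · (λ₂ − λ₁) · |λ₁ − b| · |λ₂ − b| · 1{λ₁ < λ₂ < b} d(λ₁,λ₂) equals (1/√(3−κ²)) · exp(−κ²x̃²/(2(3−κ²))) · Φ(κx̃/√((2−κ²)(3−κ²))) + (κ²/2)(x̃² − 1) · Φ(κx̃/√(2−κ²)) + (κ√(2−κ²)·x̃/(2√(2π))) · exp(−κ²x̃²/(2(2−κ²))). -/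

import Mathlib

open MeasureTheory Real

/-- The standard Gaussian cumulative distribution function. -/
noncomputable def stdGaussCDF (x : ℝ) : ℝ :=
  ∫ y in Set.Iic x, Real.exp (-y ^ 2 / 2) / Real.sqrt (2 * Real.pi)

/-- A Gaussian integral over a half-line, in terms of the standard Gaussian CDF. -/
theorem integral_Iic_exp_neg_mul_sub_sq {r : ℝ} (hr : 0 < r) (m b : ℝ) :
    ∫ t in Set.Iic b, exp (-r * (t - m) ^ 2)
      = √(π / r) * stdGaussCDF (√(2 * r) * (b - m)) := by
  have hs : 0 < √(2 * r) := by positivity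
  have hs2 : √(2 * r) ^ 2 = 2 * r := sq_sqrt (by positivity)
  set g : ℝ → ℝ := (Set.Iic (√(2 * r) * (b - m))).indicator fun y => exp (-y ^ 2 / 2) with hg
  have hpi : (∫ y, g y) = √(2 * π) * stdGaussCDF (√(2 * r) * (b - m)) := by
    have : 0 < √(2 * π) := by positivity
    rw [hg, integral_indicator measurableSet_Iic, stdGaussCDF, integral_div]
    field_simp
  have hsub : (fun t => (Set.Iic b).indicator (fun t => exp (-r * (t - m) ^ 2)) t)
      = fun t => g (√(2 * r) * (t - m)) := by
    funext t
    have hiff : √(2 * r) * (t - m) ≤ √(2 * r) * (b - m) ↔ t ≤ b := by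
      rw [mul_le_mul_iff_right₀ hs, sub_le_sub_iff_right]
    simp only [hg, Set.indicator_apply, Set.mem_Iic, hiff, mul_pow, hs2]
    split_ifs
    · congr 1; ring
    · rfl
  rw [← integral_indicator measurableSet_Iic, hsub,
    integral_sub_right_eq_self (fun t => g (√(2 * r) * t)) m,
    Measure.integral_comp_mul_left, hpi, smul_eq_mul, abs_of_pos (by positivity),
    sqrt_mul' _ pi_pos.le, sqrt_mul' _ hr.le, sqrt_div' _ hr.le]
  have : 0 < √r := by positivity
  have : 0 < √(2 : ℝ) := by positivity
  field_simp

theorem integrable_pow_mul_exp_neg_mul_sq {r : ℝ} (hr : 0 < r) (n : ℕ) :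
    Integrable fun t : ℝ => t ^ n * exp (-r * t ^ 2) := by
  simpa using integrable_rpow_mul_exp_neg_mul_sq hr
    (show (-1 : ℝ) < n from by linarith [n.cast_nonneg (α := ℝ)])

theorem integrable_quadratic_mul_exp_neg_mul_sq {r : ℝ} (hr : 0 < r) (c₀ c₁ c₂ : ℝ) :
    Integrable fun t : ℝ => (c₀ + c₁ * t + c₂ * t ^ 2) * exp (-r * t ^ 2) := by
  have h := (((integrable_pow_mul_exp_neg_mul_sq hr 0).const_mul c₀).add
    ((integrable_pow_mul_exp_neg_mul_sq hr 1).const_mul c₁)).add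
    ((integrable_pow_mul_exp_neg_mul_sq hr 2).const_mul c₂)
  refine h.congr (.of_forall fun t => ?_)
  simp only [Pi.add_apply]
  ring

theorem integral_Iic_sub_sq_mul_exp_neg_mul_sq {r : ℝ} (hr : 0 < r) (b : ℝ) :
    ∫ t in Set.Iic b, (b - t) ^ 2 * exp (-r * t ^ 2)
      = (b ^ 2 + 1 / (2 * r)) * (√(π / r) * stdGaussCDF (√(2 * r) * b))
        + b / (2 * r) * exp (-r * b ^ 2) := by
  have hderiv : ∀ t ∈ Set.Iic b,
      HasDerivAt (fun t : ℝ => (2 * b - t) / (2 * r) * exp (-r * t ^ 2))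
        ((-1 / (2 * r) + -2 * b * t + 1 * t ^ 2) * exp (-r * t ^ 2)) t := by
    intro t _
    have h1 : HasDerivAt (fun t : ℝ => (2 * b - t) / (2 * r)) (-1 / (2 * r)) t :=
      ((hasDerivAt_id t).const_sub (2 * b)).div_const (2 * r)
    have h2 : HasDerivAt (fun t : ℝ => exp (-r * t ^ 2))
        (exp (-r * t ^ 2) * (-r * (2 * t))) t := by
      simpa using (((hasDerivAt_id t).pow 2).const_mul (-r)).exp
    refine (h1.mul h2).congr_deriv ?_
    field_simp
    ring
  have hint' := (integrable_quadratic_mul_exp_neg_mul_sq hr (-1 / (2 * r)) (-2 * b) 1).integrableOn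
    (s := Set.Iic b)
  have hint : IntegrableOn (fun t : ℝ => (2 * b - t) / (2 * r) * exp (-r * t ^ 2)) (Set.Iic b) := by
    refine ((integrable_quadratic_mul_exp_neg_mul_sq hr (2 * b / (2 * r)) (-1 / (2 * r)) 0).congr
      (.of_forall fun t => ?_)).integrableOn
    simp only
    ring
  have hparts := integral_Iic_of_hasDerivAt_of_tendsto' hderiv hint'
    (tendsto_zero_of_hasDerivAt_of_integrableOn_Iic hderiv hint' hint)
  have hgauss := integral_Iic_exp_neg_mul_sub_sq hr 0 b
  simp only [sub_zero] at hgauss hparts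
  have hsplit : ∀ t : ℝ, (b - t) ^ 2 * exp (-r * t ^ 2)
      = (b ^ 2 + 1 / (2 * r)) * exp (-r * t ^ 2)
        + (-1 / (2 * r) + -2 * b * t + 1 * t ^ 2) * exp (-r * t ^ 2) := fun t => by ring
  simp_rw [hsplit]
  rw [integral_add ((integrable_exp_neg_mul_sq hr).const_mul _).integrableOn hint',
    integral_const_mul, hgauss, hparts]
  ring

theorem integral_Iic_exp_neg_sub_sq_mul_exp_neg_mul_sq {r : ℝ} (hr : 0 < r) (b : ℝ) :
    ∫ t in Set.Iic b, exp (-(b - t) ^ 2) * exp (-r * t ^ 2)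
      = exp (-(r / (1 + r) * b ^ 2))
        * (√(π / (1 + r)) * stdGaussCDF (√(2 * (1 + r)) * (b - b / (1 + r)))) := by
  rw [← integral_Iic_exp_neg_mul_sub_sq (by positivity), ← integral_const_mul]
  congr 1 with t
  rw [← exp_add, ← exp_add]
  congr 1
  field_simp
  ring

theorem integrable_exp_neg_sub_sq_mul_exp_neg_mul_sq {r : ℝ} (hr : 0 < r) (b : ℝ) :
    Integrable fun t : ℝ => exp (-(b - t) ^ 2) * exp (-r * t ^ 2) := by
  refine (integrable_exp_neg_mul_sq hr).mono' (by fun_prop) (.of_forall fun t => ?_)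
  rw [norm_of_nonneg (by positivity)]
  exact mul_le_of_le_one_left (exp_pos _).le (exp_le_one_iff.2 (by nlinarith [sq_nonneg (b - t)]))

theorem integral_Ioo_mul_sub_sq_mul_exp {c : ℝ} (hc : 0 ≤ c) :
    ∫ d in Set.Ioo 0 (2 * c), d * (c ^ 2 - d ^ 2 / 4) * exp (-(1 / 4) * d ^ 2)
      = 2 * (c ^ 2 - 1 + exp (-c ^ 2)) := by
  have hderiv : ∀ d ∈ Set.uIcc 0 (2 * c),
      HasDerivAt (fun d : ℝ => (2 - 2 * (c ^ 2 - d ^ 2 / 4)) * exp (-(1 / 4) * d ^ 2))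
        (d * (c ^ 2 - d ^ 2 / 4) * exp (-(1 / 4) * d ^ 2)) d := by
    intro d _
    have h0 : HasDerivAt (fun d : ℝ => d ^ 2) (2 * d) d := by
      simpa using hasDerivAt_pow 2 d
    have h1 : HasDerivAt (fun d : ℝ => 2 - 2 * (c ^ 2 - d ^ 2 / 4)) (-(2 * -(2 * d / 4))) d :=
      (((h0.div_const 4).const_sub (c ^ 2)).const_mul 2).const_sub 2
    refine (h1.mul (h0.const_mul (-(1 / 4))).exp).congr_deriv ?_
    ring
  rw [← integral_Ioc_eq_integral_Ioo, ← intervalIntegral.integral_of_le (by positivity),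
    intervalIntegral.integral_eq_sub_of_hasDerivAt hderiv
      (Continuous.intervalIntegrable (by fun_prop) _ _),
    show -(1 / 4) * (2 * c) ^ 2 = -c ^ 2 by ring]
  simp
  ring

/-- The shear `(d, t) ↦ (t - d / 2, t + d / 2)` preserves the area of the plane. -/
theorem measurePreserving_sub_half_add_half :
    MeasurePreserving (fun p : ℝ × ℝ => (p.2 - p.1 / 2, p.2 + p.1 / 2)) := by
  have h1 : MeasurePreserving (fun p : ℝ × ℝ => (p.1, p.2 - p.1 / 2))
      (volume.prod volume) (volume.prod volume) :=
    (MeasurePreserving.id volume).skew_product (g := fun d t => t - d / 2) (by fun_prop)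
      (.of_forall fun d => (measurePreserving_sub_right volume (d / 2)).map_eq)
  have h2 := (measurePreserving_prod_add (volume : Measure ℝ) (volume : Measure ℝ)).comp
    (Measure.measurePreserving_swap.comp h1)
  refine ⟨by fun_prop, ?_⟩
  rw [Measure.volume_eq_prod]
  convert h2.map_eq using 2
  funext p
  ext <;> simp
  ring

theorem integral_comp_sub_half_add_half (F : ℝ × ℝ → ℝ) :
    ∫ p : ℝ × ℝ, F (p.2 - p.1 / 2, p.2 + p.1 / 2) = ∫ p, F p := by
  let e : (ℝ × ℝ) ≃ₜ (ℝ × ℝ) :=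
    { toFun := fun p => (p.2 - p.1 / 2, p.2 + p.1 / 2)
      invFun := fun p => (p.2 - p.1, (p.1 + p.2) / 2)
      left_inv := fun p => by ext <;> simp
      right_inv := fun p => by ext <;> simp <;> ring }
  exact measurePreserving_sub_half_add_half.integral_comp e.measurableEmbedding F

theorem integrable_mul_sub_sq_mul_exp_mul_exp {r : ℝ} (hr : 0 < r) (b : ℝ) :
    Integrable fun p : ℝ × ℝ =>
      p.1 * ((b - p.2) ^ 2 - p.1 ^ 2 / 4) * exp (-(1 / 4) * p.1 ^ 2) * exp (-r * p.2 ^ 2) := by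
  have h4 : (0 : ℝ) < 1 / 4 := by norm_num
  have h := ((integrable_pow_mul_exp_neg_mul_sq h4 1).mul_prod
    (integrable_quadratic_mul_exp_neg_mul_sq hr (b ^ 2) (-2 * b) 1)).add
    ((integrable_pow_mul_exp_neg_mul_sq h4 3).mul_prod
    ((integrable_exp_neg_mul_sq hr).const_mul (-1 / 4)))
  refine h.congr (.of_forall fun p => ?_)
  simp only [Pi.add_apply]
  ring

theorem integral_indicator_mul_sub_sq {r : ℝ} (hr : 0 < r) (b : ℝ) :
    ∫ p : ℝ × ℝ, {q : ℝ × ℝ | 0 < q.1 ∧ q.2 + q.1 / 2 < b}.indicator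
        (fun q => q.1 * ((b - q.2) ^ 2 - q.1 ^ 2 / 4) * exp (-(1 / 4) * q.1 ^ 2)
          * exp (-r * q.2 ^ 2)) p
      = ∫ t in Set.Iic b, 2 * ((b - t) ^ 2 - 1 + exp (-(b - t) ^ 2)) * exp (-r * t ^ 2) := by
  have hmeas : MeasurableSet {q : ℝ × ℝ | 0 < q.1 ∧ q.2 + q.1 / 2 < b} :=
    (measurableSet_lt measurable_const measurable_fst).inter
      (measurableSet_lt (measurable_snd.add (measurable_fst.div_const 2)) measurable_const)
  rw [Measure.volume_eq_prod, integral_prod_symm _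
    ((integrable_mul_sub_sq_mul_exp_mul_exp hr b).indicator hmeas),
    ← integral_indicator measurableSet_Iic]
  congr 1 with t
  have hfiber : ∀ d : ℝ, {q : ℝ × ℝ | 0 < q.1 ∧ q.2 + q.1 / 2 < b}.indicator
        (fun q => q.1 * ((b - q.2) ^ 2 - q.1 ^ 2 / 4) * exp (-(1 / 4) * q.1 ^ 2)
          * exp (-r * q.2 ^ 2)) (d, t)
      = (Set.Ioo 0 (2 * (b - t))).indicator
        (fun d => d * ((b - t) ^ 2 - d ^ 2 / 4) * exp (-(1 / 4) * d ^ 2)) d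
          * exp (-r * t ^ 2) := by
    intro d
    have hiff : (0 < d ∧ t + d / 2 < b) ↔ (0 < d ∧ d < 2 * (b - t)) :=
      and_congr_right fun _ => ⟨fun h => by linarith, fun h => by linarith⟩
    simp only [Set.indicator_apply, Set.mem_ofPred_eq, Set.mem_Ioo, hiff]
    split_ifs <;> simp
  simp_rw [hfiber]
  rw [integral_mul_const, integral_indicator measurableSet_Ioo]
  by_cases ht : t ≤ b
  · rw [integral_Ioo_mul_sub_sq_mul_exp (sub_nonneg.2 ht), Set.indicator_of_mem (Set.mem_Iic.2 ht)]
  · rw [Set.Ioo_eq_empty (by linarith), Set.indicator_of_notMem (mt Set.mem_Iic.1 ht)]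
    simp

theorem integral_Iic_sub_sq_sub_one_add_exp_mul_exp {r : ℝ} (hr : 0 < r) (b : ℝ) :
    ∫ t in Set.Iic b, 2 * ((b - t) ^ 2 - 1 + exp (-(b - t) ^ 2)) * exp (-r * t ^ 2)
      = 2 * ((b ^ 2 + 1 / (2 * r) - 1) * (√(π / r) * stdGaussCDF (√(2 * r) * b))
        + b / (2 * r) * exp (-r * b ^ 2)
        + exp (-(r / (1 + r) * b ^ 2))
          * (√(π / (1 + r)) * stdGaussCDF (√(2 * (1 + r)) * (b - b / (1 + r))))) := by
  have hgauss := integral_Iic_exp_neg_mul_sub_sq hr 0 b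
  simp only [sub_zero] at hgauss
  have hsq : Integrable fun t : ℝ => (b - t) ^ 2 * exp (-r * t ^ 2) :=
    (integrable_quadratic_mul_exp_neg_mul_sq hr (b ^ 2) (-2 * b) 1).congr
      (.of_forall fun t => by simp only; ring)
  have hsplit : ∀ t : ℝ, 2 * ((b - t) ^ 2 - 1 + exp (-(b - t) ^ 2)) * exp (-r * t ^ 2)
      = 2 * ((b - t) ^ 2 * exp (-r * t ^ 2) - exp (-r * t ^ 2)
        + exp (-(b - t) ^ 2) * exp (-r * t ^ 2)) := fun t => by ring
  simp_rw [hsplit]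
  rw [integral_const_mul, integral_add, integral_sub,
    integral_Iic_sub_sq_mul_exp_neg_mul_sq hr, hgauss,
    integral_Iic_exp_neg_sub_sq_mul_exp_neg_mul_sq hr]
  · ring
  · exact hsq.integrableOn
  · exact (integrable_exp_neg_mul_sq hr).integrableOn
  · exact hsq.integrableOn.sub (integrable_exp_neg_mul_sq hr).integrableOn
  · exact (integrable_exp_neg_sub_sq_mul_exp_neg_mul_sq hr b).integrableOn

/-- For `0 < κ < √2` and real `x̃`, with `b = κ·x̃/√2`, the quantity
`(1/(2√(π(2−κ²)))) ∫_{ℝ²} exp{−(1/2)(λ₁²+λ₂²) + ((1−κ²)/(4(2−κ²)))(λ₁+λ₂)²}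
  ·(λ₂−λ₁)·|λ₁−b|·|λ₂−b|·1{λ₁<λ₂<b}` equals the stated explicit expression. -/
theorem stmt_6 (κ x : ℝ) (hκ : 0 < κ) (hκ2 : κ < Real.sqrt 2) :
    (1 / (2 * Real.sqrt (Real.pi * (2 - κ ^ 2))))
      * (∫ p : ℝ × ℝ,
          Set.indicator {q : ℝ × ℝ | q.1 < q.2 ∧ q.2 < κ * x / Real.sqrt 2}
            (fun q =>
              Real.exp (-(1 / 2) * (q.1 ^ 2 + q.2 ^ 2)
                  + (1 - κ ^ 2) / (4 * (2 - κ ^ 2)) * (q.1 + q.2) ^ 2)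
                * (q.2 - q.1)
                * (|q.1 - κ * x / Real.sqrt 2| * |q.2 - κ * x / Real.sqrt 2|)) p)
    = 1 / Real.sqrt (3 - κ ^ 2) * Real.exp (-(κ ^ 2 * x ^ 2) / (2 * (3 - κ ^ 2)))
        * stdGaussCDF (κ * x / Real.sqrt ((2 - κ ^ 2) * (3 - κ ^ 2)))
      + κ ^ 2 / 2 * (x ^ 2 - 1) * stdGaussCDF (κ * x / Real.sqrt (2 - κ ^ 2))
      + κ * Real.sqrt (2 - κ ^ 2) * x / (2 * Real.sqrt (2 * Real.pi))
        * Real.exp (-(κ ^ 2 * x ^ 2) / (2 * (2 - κ ^ 2))) := by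
  have hκsq : κ ^ 2 < 2 := (lt_sqrt hκ.le).1 hκ2
  have hA : 0 < 2 - κ ^ 2 := by linarith
  have hM : 0 < 3 - κ ^ 2 := by linarith
  have hr : 0 < (2 - κ ^ 2)⁻¹ := inv_pos.2 hA
  have h2 : √(2 : ℝ) ^ 2 = 2 := sq_sqrt (by norm_num)
  have hs2 : 0 < √(2 : ℝ) := by positivity
  have hb : (κ * x / √2) ^ 2 = κ ^ 2 * x ^ 2 / 2 := by rw [div_pow, mul_pow, h2]
  have hint := integral_indicator_mul_sub_sq hr (κ * x / √2)
  rw [integral_Iic_sub_sq_sub_one_add_exp_mul_exp hr] at hint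
  rw [← integral_comp_sub_half_add_half]
  have hcongr : ∀ p : ℝ × ℝ,
      Set.indicator {q : ℝ × ℝ | q.1 < q.2 ∧ q.2 < κ * x / √2}
        (fun q => exp (-(1 / 2) * (q.1 ^ 2 + q.2 ^ 2)
            + (1 - κ ^ 2) / (4 * (2 - κ ^ 2)) * (q.1 + q.2) ^ 2)
          * (q.2 - q.1) * (|q.1 - κ * x / √2| * |q.2 - κ * x / √2|))
        (p.2 - p.1 / 2, p.2 + p.1 / 2)
      = {q : ℝ × ℝ | 0 < q.1 ∧ q.2 + q.1 / 2 < κ * x / √2}.indicator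
        (fun q => q.1 * ((κ * x / √2 - q.2) ^ 2 - q.1 ^ 2 / 4) * exp (-(1 / 4) * q.1 ^ 2)
          * exp (-(2 - κ ^ 2)⁻¹ * q.2 ^ 2)) p := by
    rintro ⟨d, t⟩
    generalize κ * x / √2 = b
    have hiff : (t - d / 2 < t + d / 2 ∧ t + d / 2 < b) ↔ (0 < d ∧ t + d / 2 < b) :=
      and_congr_left fun _ => ⟨fun h => by linarith, fun h => by linarith⟩
    simp only [Set.indicator_apply, Set.mem_ofPred_eq, hiff]
    split_ifs with h
    · rw [abs_of_nonpos (by linarith), abs_of_nonpos (by linarith),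
        show -(1 / 2) * ((t - d / 2) ^ 2 + (t + d / 2) ^ 2)
            + (1 - κ ^ 2) / (4 * (2 - κ ^ 2)) * (t - d / 2 + (t + d / 2)) ^ 2
          = -(1 / 4) * d ^ 2 + -(2 - κ ^ 2)⁻¹ * t ^ 2 by field_simp; ring, exp_add]
      ring
    · rfl
  simp_rw [hcongr]
  rw [hint, hb]
  have hsA : 0 < √(2 - κ ^ 2) := by positivity
  have hsM : 0 < √(3 - κ ^ 2) := by positivity
  have hsA2 : √(2 - κ ^ 2) ^ 2 = 2 - κ ^ 2 := sq_sqrt hA.le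
  have hsM2 : √(3 - κ ^ 2) ^ 2 = 3 - κ ^ 2 := sq_sqrt hM.le
  have hsπ : 0 < √π := by positivity
  have hr1 : 1 + (2 - κ ^ 2)⁻¹ = (3 - κ ^ 2) / (2 - κ ^ 2) := by field_simp; ring
  have harg1 : √(2 * (2 - κ ^ 2)⁻¹) * (κ * x / √2) = κ * x / √(2 - κ ^ 2) := by
    rw [sqrt_mul (by norm_num), sqrt_inv]
    field_simp
  have harg2 : √(2 * ((3 - κ ^ 2) / (2 - κ ^ 2))) *
      (κ * x / √2 - κ * x / √2 / ((3 - κ ^ 2) / (2 - κ ^ 2)))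
      = κ * x / √((2 - κ ^ 2) * (3 - κ ^ 2)) := by
    have hsub : κ * x / √2 - κ * x / √2 / ((3 - κ ^ 2) / (2 - κ ^ 2))
        = κ * x / √2 / √(3 - κ ^ 2) ^ 2 := by
      rw [hsM2]; field_simp; ring
    rw [hsub, sqrt_mul (by norm_num), sqrt_div hM.le, sqrt_mul hA.le]
    field_simp
  have hexp1 : -(2 - κ ^ 2)⁻¹ * (κ ^ 2 * x ^ 2 / 2) = -(κ ^ 2 * x ^ 2) / (2 * (2 - κ ^ 2)) := by
    field_simp
  have hexp2 : -((2 - κ ^ 2)⁻¹ / ((3 - κ ^ 2) / (2 - κ ^ 2)) * (κ ^ 2 * x ^ 2 / 2))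
      = -(κ ^ 2 * x ^ 2) / (2 * (3 - κ ^ 2)) := by
    field_simp
  have hsq1 : √(π / (2 - κ ^ 2)⁻¹) = √π * √(2 - κ ^ 2) := by
    rw [div_inv_eq_mul, sqrt_mul pi_pos.le]
  have hsq2 : √(π / ((3 - κ ^ 2) / (2 - κ ^ 2))) = √π * √(2 - κ ^ 2) / √(3 - κ ^ 2) := by
    rw [div_div_eq_mul_div, sqrt_div (by positivity), sqrt_mul pi_pos.le]
  have hinv : 1 / (2 * (2 - κ ^ 2)⁻¹) = (2 - κ ^ 2) / 2 := by field_simp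
  have hcoef : κ * x / √2 / (2 * (2 - κ ^ 2)⁻¹) = κ * x * √(2 - κ ^ 2) ^ 2 / (2 * √2) := by
    rw [hsA2]; field_simp
  rw [hr1, harg1, harg2, hexp1, hexp2, hsq1, hsq2, hinv, hcoef, sqrt_mul pi_pos.le,
    sqrt_mul (by norm_num : (0 : ℝ) ≤ 2)]
  field_simp
  ring
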